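/- Let S₂ = {(−1,−1,−1), (−1,0,0), (−1,0,1), (−1,1,0), (1,−1,0), (1,0,−1), (1,1,1)} and let φ_x, φ_y, φ_z be the associated automorphisms of ℚ(x,y,z). Then the composition φ_z ∘ φ_y ∘ φ_z equals the automorphism of ℚ(x,y,z) that exchanges y and z and fixes x. -/

import Mathlib

noncomputable section

/-- The field `ℚ(x,y,z)` of rational functions in three variables. -/
abbrev K : Type := FractionRing (MvPolynomial (Fin 3) ℚ)

/-- The variables `x = Xv 0`, `y = Xv 1`, `z = Xv 2` of `ℚ(x,y,z)`. -/
def Xv (i : Fin 3) : K := algebraMap (MvPolynomial (Fin 3) ℚ) K (MvPolynomial.X i)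

/-- For a stepset `S`, the Laurent polynomial `Bm S c e = Σ_{s ∈ S, s c = e}`
(monomial in the two variables other than the `c`-th one); e.g.
`Bm S 0 (-1) = B₋(y,z) = Σ_{(−1,v,w)∈S} y^v z^w`. -/
def Bm (S : Finset (Fin 3 → ℤ)) (c : Fin 3) (e : ℤ) : K :=
  ∑ s ∈ S.filter (fun s => s c = e), ∏ i ∈ Finset.univ.erase c, Xv i ^ (s i)

/-- `φ` is the automorphism `φ_c` of `ℚ(x,y,z)` associated to the stepset `S`
and the coordinate `c`: it sends the `c`-th variable `x_c` to
`x_c⁻¹ · B₋/B₊` (where `B∓ = Σ_{s ∈ S, s c = ∓1}` of the monomials in the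
other two variables) and fixes the other two variables. -/
def IsPhi (S : Finset (Fin 3 → ℤ)) (c : Fin 3) (φ : K ≃ₐ[ℚ] K) : Prop :=
  φ (Xv c) = (Xv c)⁻¹ * Bm S c (-1) / Bm S c 1 ∧ ∀ i ≠ c, φ (Xv i) = Xv i

/-- The stepset `S₂`. -/
def S₂ : Finset (Fin 3 → ℤ) :=
  {![-1,-1,-1], ![-1,0,0], ![-1,0,1], ![-1,1,0], ![1,-1,0], ![1,0,-1], ![1,1,1]}

/-- The automorphism of `ℚ(x,y,z)` that exchanges `y` and `z` and fixes `x`. -/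
def swapYZ : K ≃ₐ[ℚ] K :=
  IsFractionRing.algEquivOfAlgEquiv (MvPolynomial.renameEquiv ℚ (Equiv.swap (1 : Fin 3) 2))

theorem Xv_ne_zero (i : Fin 3) : Xv i ≠ 0 :=
  (map_ne_zero_iff _ (IsFractionRing.injective (MvPolynomial (Fin 3) ℚ) K)).2
    (MvPolynomial.X_ne_zero i)

theorem one_add_sq_mul_Xv_ne_zero (i j : Fin 3) : 1 + Xv i ^ 2 * Xv j ≠ 0 := by
  have hp : (1 + MvPolynomial.X i ^ 2 * MvPolynomial.X j : MvPolynomial (Fin 3) ℚ) ≠ 0 := by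
    intro h
    simpa using congrArg (MvPolynomial.eval 0) h
  simpa [Xv] using
    (map_ne_zero_iff _ (IsFractionRing.injective (MvPolynomial (Fin 3) ℚ) K)).2 hp

theorem swapYZ_Xv (i : Fin 3) : swapYZ (Xv i) = Xv (Equiv.swap 1 2 i) := by
  simp [swapYZ, Xv]

theorem algEquiv_ext_Xv {f g : K ≃ₐ[ℚ] K} (h : ∀ i, f (Xv i) = g (Xv i)) : f = g := by
  have hp : (f : K →ₐ[ℚ] K).comp (IsScalarTower.toAlgHom ℚ (MvPolynomial (Fin 3) ℚ) K) =
      (g : K →ₐ[ℚ] K).comp (IsScalarTower.toAlgHom ℚ (MvPolynomial (Fin 3) ℚ) K) :=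
    MvPolynomial.algHom_ext h
  have hr : (f : K →+* K) = g :=
    IsLocalization.ringHom_ext (nonZeroDivisors (MvPolynomial (Fin 3) ℚ))
      (RingHom.ext fun p => DFunLike.congr_fun hp p)
  exact AlgEquiv.ext fun a => DFunLike.congr_fun hr a

theorem Bm_S₂_y_neg : Bm S₂ 1 (-1) = (Xv 0)⁻¹ * (Xv 2)⁻¹ + Xv 0 := by
  have hs : S₂.filter (fun s => s 1 = -1) = {![-1,-1,-1], ![1,-1,0]} := by decide
  have he : Finset.univ.erase (1 : Fin 3) = {0, 2} := by decide
  rw [Bm, hs, he, Finset.sum_pair (by decide)]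
  simp

theorem Bm_S₂_y_pos : Bm S₂ 1 1 = (Xv 0)⁻¹ + Xv 0 * Xv 2 := by
  have hs : S₂.filter (fun s => s 1 = 1) = {![-1,1,0], ![1,1,1]} := by decide
  have he : Finset.univ.erase (1 : Fin 3) = {0, 2} := by decide
  rw [Bm, hs, he, Finset.sum_pair (by decide)]
  simp

theorem Bm_S₂_z_neg : Bm S₂ 2 (-1) = (Xv 0)⁻¹ * (Xv 1)⁻¹ + Xv 0 := by
  have hs : S₂.filter (fun s => s 2 = -1) = {![-1,-1,-1], ![1,0,-1]} := by decide
  have he : Finset.univ.erase (2 : Fin 3) = {0, 1} := by decide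
  rw [Bm, hs, he, Finset.sum_pair (by decide)]
  simp

theorem Bm_S₂_z_pos : Bm S₂ 2 1 = (Xv 0)⁻¹ + Xv 0 * Xv 1 := by
  have hs : S₂.filter (fun s => s 2 = 1) = {![-1,0,1], ![1,1,1]} := by decide
  have he : Finset.univ.erase (2 : Fin 3) = {0, 1} := by decide
  rw [Bm, hs, he, Finset.sum_pair (by decide)]
  simp

/-- The common quotient `B₋/B₊` of `S₂` in the second and third coordinates. -/
theorem quotient_eq_inv (j : Fin 3) :
    ((Xv 0)⁻¹ * (Xv j)⁻¹ + Xv 0) / ((Xv 0)⁻¹ + Xv 0 * Xv j) = (Xv j)⁻¹ := by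
  have h0 := Xv_ne_zero 0
  have hj := Xv_ne_zero j
  have hB : (Xv 0)⁻¹ + Xv 0 * Xv j ≠ 0 := by
    have h : (Xv 0)⁻¹ + Xv 0 * Xv j = (Xv 0)⁻¹ * (1 + Xv 0 ^ 2 * Xv j) := by field_simp
    rw [h]
    exact mul_ne_zero (inv_ne_zero h0) (one_add_sq_mul_Xv_ne_zero 0 j)
  rw [div_eq_iff hB]
  field_simp

/-- For the stepset `S₂`, the composition `φ_z ∘ φ_y ∘ φ_z` of the associated
automorphisms of `ℚ(x,y,z)` equals the automorphism exchanging `y` and `z`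
and fixing `x`. -/
theorem phi_zyz_eq_swap (φy φz : K ≃ₐ[ℚ] K)
    (hy : IsPhi S₂ 1 φy) (hz : IsPhi S₂ 2 φz) :
    (φz.trans φy).trans φz = swapYZ := by
  obtain ⟨hyy, hy⟩ := hy
  obtain ⟨hzz, hz⟩ := hz
  rw [Bm_S₂_y_neg, Bm_S₂_y_pos, mul_div_assoc, quotient_eq_inv] at hyy
  rw [Bm_S₂_z_neg, Bm_S₂_z_pos, mul_div_assoc, quotient_eq_inv] at hzz
  have hyx := hy 0 (by decide)
  have hyz := hy 2 (by decide)
  have hzx := hz 0 (by decide)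
  have hzy := hz 1 (by decide)
  have h1 := Xv_ne_zero 1
  have h2 := Xv_ne_zero 2
  refine algEquiv_ext_Xv fun i => ?_
  rw [swapYZ_Xv, AlgEquiv.trans_apply, AlgEquiv.trans_apply]
  fin_cases i
  · change φz (φy (φz (Xv 0))) = Xv 0
    rw [hzx, hyx, hzx]
  · change φz (φy (φz (Xv 1))) = Xv 2
    rw [hzy, hyy, map_mul, map_inv₀, map_inv₀, hzy, hzz]
    field_simp
  · change φz (φy (φz (Xv 2))) = Xv 1
    rw [hzz, map_mul, map_inv₀, map_inv₀, hyz, hyy]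
    have h : (Xv 2)⁻¹ * ((Xv 1)⁻¹ * (Xv 2)⁻¹)⁻¹ = Xv 1 := by field_simp
    rw [h, hzy]
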